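/- arXiv:1510.06663 — 3 statements merged into one kernel-verified Lean document; each statement's English description precedes it below -/
import Mathlib

section
/- Let U ⊆ ℝ² be a connected open set, let τ : Ũ → U be a universal covering map of U, let h : U → U be a homeomorphism, and let C ⊆ U be a continuum such that h⁻¹(C) ∪ C ⊆ U and h⁻¹(C) ∪ C is an acyclic continuum, and such that every connected component of τ⁻¹(h⁻¹(C) ∪ C) is mapped homeomorphically onto h⁻¹(C) ∪ C by τ. Suppose c ∈ C satisfies h⁻ⁱ(c) ∈ C for every positive integer i. Let C̃ be a connected component of τ⁻¹(C), let x = h⁻¹(c), choose x̃ ∈ τ⁻¹(x) ∩ C̃ and ỹ ∈ τ⁻¹(c) ∩ C̃, and let h̃ : Ũ → Ũ be the lift of h determined by h̃(x̃) = ỹ. Then h̃⁻ⁱ(x̃) ∈ C̃ for every positive integer i; in particular the backward orbit of x̃ under h̃ is bounded (contained in the compact set C̃). -/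
/-- A (planar) continuum: a compact connected subset of the plane
containing more than one point. -/
def IsContinuum (C : Set (ℝ × ℝ)) : Prop :=
  IsCompact C ∧ IsConnected C ∧ C.Nontrivial

/-- A planar set is acyclic if its complement is connected
(it does not separate the plane). -/
def IsAcyclic (K : Set (ℝ × ℝ)) : Prop :=
  IsConnected Kᶜ

/-- A homeomorphism of the plane is isotopic to the identity if there is a
continuous family of homeomorphisms joining the identity to it. -/
def IsotopicToIdentity (h : (ℝ × ℝ) ≃ₜ (ℝ × ℝ)) : Prop :=
  ∃ F : ℝ → (ℝ × ℝ) → (ℝ × ℝ),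
    Continuous (fun q : ℝ × (ℝ × ℝ) => F q.1 q.2) ∧
    (∀ t : ℝ, ∃ g : (ℝ × ℝ) ≃ₜ (ℝ × ℝ), ⇑g = F t) ∧
    F 0 = id ∧ F 1 = ⇑h

/-- If `τ` maps the connected component of `z` in `τ ⁻¹' K` homeomorphically onto `K ⊇ C`, with
`C` connected and `τ z ∈ C`, then the connected component of `z` in `τ ⁻¹' C` is the part of that
component lying over `C`, and it is the range of a continuous section of `τ` over `C`. -/
theorem exists_continuous_section_range_eq_connectedComponentIn
    {E X : Type*} [TopologicalSpace E] [TopologicalSpace X] {τ : E → X} {C K : Set X} {z : E}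
    (hC : IsConnected C) (hCK : C ⊆ K) (hz : τ z ∈ C)
    (e : connectedComponentIn (τ ⁻¹' K) z ≃ₜ K)
    (he : ∀ w : connectedComponentIn (τ ⁻¹' K) z, τ (w : E) = (e w : X)) :
    ∃ s : C → E, Continuous s ∧ Set.range s = connectedComponentIn (τ ⁻¹' C) z ∧
      connectedComponentIn (τ ⁻¹' C) z = connectedComponentIn (τ ⁻¹' K) z ∩ τ ⁻¹' C := by
  set s : C → E := fun p ↦ (e.symm (Set.inclusion hCK p) : E) with hs
  have hsc : Continuous s :=
    continuous_subtype_val.comp (e.symm.continuous.comp (continuous_inclusion hCK))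
  have hτs (p : C) : τ (s p) = p := by simp [hs, he]
  have hsub : connectedComponentIn (τ ⁻¹' K) z ∩ τ ⁻¹' C ⊆ Set.range s := by
    rintro w ⟨hwK, hwC⟩
    refine ⟨⟨τ w, hwC⟩, ?_⟩
    have : Set.inclusion hCK ⟨τ w, hwC⟩ = e ⟨w, hwK⟩ := Subtype.ext (he ⟨w, hwK⟩)
    simp [hs, this]
  have : ConnectedSpace C := isConnected_iff_connectedSpace.mp hC
  have hrange : Set.range s ⊆ connectedComponentIn (τ ⁻¹' C) z :=
    (isPreconnected_range hsc).subset_connectedComponentIn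
      (hsub ⟨mem_connectedComponentIn (hCK hz), hz⟩)
      (Set.range_subset_iff.mpr fun p ↦ by simp [hτs])
  have hmono : connectedComponentIn (τ ⁻¹' C) z ⊆ connectedComponentIn (τ ⁻¹' K) z ∩ τ ⁻¹' C :=
    Set.subset_inter (connectedComponentIn_mono z (Set.preimage_mono hCK))
      (connectedComponentIn_subset _ _)
  exact ⟨s, hsc, hrange.antisymm (hmono.trans hsub), hmono.antisymm (hsub.trans hrange)⟩

/-- **Claims 1 and 2 of the proof of Theorem 1.** Let `τ : Ũ → U` be a
universal covering of a connected open planar set `U`, let `h : U ≃ₜ U`, and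
let `C ⊆ U` be a continuum such that `K = h⁻¹(C) ∪ C` is an acyclic continuum
every component of whose `τ`-preimage maps homeomorphically onto `K` by `τ`.
If `c ∈ C` has its whole backward orbit in `C`, `C̃` is a component of
`τ⁻¹(C)`, `x = h⁻¹(c)`, `x̃ ∈ τ⁻¹(x) ∩ C̃`, `ỹ ∈ τ⁻¹(c) ∩ C̃`, and `h̃` is the
lift of `h` with `h̃(x̃) = ỹ`, then `h̃⁻ⁱ(x̃) ∈ C̃` for every `i ≥ 1`; in
particular the backward orbit of `x̃` is contained in the compact set `C̃`. -/
theorem backward_orbit_of_lift_in_component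
    (U : Set (ℝ × ℝ)) (hUo : IsOpen U) (hUc : IsConnected U)
    (Ut : Type) [TopologicalSpace Ut] [SimplyConnectedSpace Ut]
    (τ : Ut → U) (hτ : IsCoveringMap τ)
    (h : U ≃ₜ U)
    (C : Set U) (hCc : IsCompact C) (hCconn : IsConnected C) (hCnt : C.Nontrivial)
    (K : Set U) (hKdef : K = ⇑h ⁻¹' C ∪ C)
    (hKcont : IsCompact K ∧ IsConnected K ∧ K.Nontrivial)
    (hKacyc : IsConnected ((Subtype.val '' K : Set (ℝ × ℝ))ᶜ))
    (hlift : ∀ z : Ut, z ∈ τ ⁻¹' K →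
      ∃ e : (connectedComponentIn (τ ⁻¹' K) z) ≃ₜ K,
        ∀ w : (connectedComponentIn (τ ⁻¹' K) z), τ (w : Ut) = ((e w : K) : U))
    (c : U) (hc : c ∈ C) (hcb : ∀ i : ℕ, 0 < i → (⇑h.symm)^[i] c ∈ C)
    (z : Ut) (hz : z ∈ τ ⁻¹' C)
    (Ct : Set Ut) (hCt : Ct = connectedComponentIn (τ ⁻¹' C) z)
    (x : U) (hx : x = h.symm c)
    (xt yt : Ut) (hxt : τ xt = x) (hxtC : xt ∈ Ct)
    (hyt : τ yt = c) (hytC : yt ∈ Ct)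
    (ht : Ut ≃ₜ Ut) (hcomm : ∀ w : Ut, τ (ht w) = h (τ w)) (hdet : ht xt = yt) :
    IsCompact Ct ∧ ∀ i : ℕ, 0 < i → (⇑ht.symm)^[i] xt ∈ Ct := by
  subst hCt hx hKdef
  have hCK : C ⊆ ⇑h ⁻¹' C ∪ C := Set.subset_union_right
  obtain ⟨e, he⟩ := hlift z (hCK hz)
  obtain ⟨s, hsc, hs, hCt⟩ :=
    exists_continuous_section_range_eq_connectedComponentIn hCconn hCK hz e he
  set Kt := connectedComponentIn (τ ⁻¹' (⇑h ⁻¹' C ∪ C)) z with hKt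
  set Ct := connectedComponentIn (τ ⁻¹' C) z
  have hxtK : xt ∈ Kt := (hCt.subset hxtC).1
  have hpre : ht.symm '' Ct ⊆ Kt := by
    rw [hKt, connectedComponentIn_eq hxtK]
    refine (isPreconnected_connectedComponentIn.image _
      ht.symm.continuous.continuousOn).subset_connectedComponentIn
      ⟨yt, hytC, by simp [← hdet]⟩ ?_
    rintro _ ⟨w, hw, rfl⟩
    refine Or.inl ?_
    rw [Set.mem_preimage, ← hcomm, ht.apply_symm_apply]
    exact (hCt.subset hw).2
  have hsemi : Function.Semiconj τ ht.symm h.symm := fun w ↦ by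
    rw [h.eq_symm_apply, ← hcomm, ht.apply_symm_apply]
  refine ⟨?_, fun i hi ↦ ?_⟩
  · have : CompactSpace C := isCompact_iff_compactSpace.mp hCc
    exact hs ▸ isCompact_range hsc
  · clear hi
    induction i with
    | zero => exact hxtC
    | succ i ih =>
      rw [hCt]
      refine ⟨hpre ⟨_, ih, (Function.iterate_succ_apply' _ _ _).symm⟩, ?_⟩
      rw [Set.mem_preimage, hsemi.iterate_right (i + 1) xt, hxt, ← Function.iterate_succ_apply]
      exact hcb _ (Nat.succ_pos _)
end

section
/- There exist an orientation reversing homeomorphism H : ℝ² → ℝ² and a continuum C ⊆ ℝ² such that: (1) H⁻¹(C) ∪ C is an acyclic continuum and for every integer k ≥ 1 it contains a periodic orbit of H of least period 2k; (2) every orbit of H is bounded (for every p ∈ ℝ², the set {Hⁿ(p) : n ∈ ℤ} is bounded); and (3) H has no fixed points. -/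
open Filter Topology

theorem eq_of_continuous_of_forall_exists_int {f : ℝ → ℝ} (hf : Continuous f)
    (hn : ∀ x, ∃ n : ℤ, f x = n) (a b : ℝ) : f a = f b := by
  choose n hn using hn
  have hc : Continuous n := by
    rw [Int.isClosedEmbedding_coe_real.isEmbedding.continuous_iff]
    exact hf.congr hn
  rw [hn, hn, PreconnectedSpace.constant inferInstance hc (x := a) (y := b)]

theorem exists_int_im_sub_of_exp_eq {z w : ℂ} (h : Complex.exp z = Complex.exp w) :
    ∃ n : ℤ, (z - w).im / (2 * Real.pi) = n := by
  obtain ⟨n, hn⟩ := Complex.exp_eq_exp_iff_exists_int.1 h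
  refine ⟨n, ?_⟩
  rw [hn]
  have := Real.pi_pos
  simp

theorem im_sub_of_exp_eq_mul_exp {u : ℝ → ℂ} (hu : Continuous u) (c : ℂ) (σ : ℝ)
    (h : ∀ θ : ℝ, Complex.exp (u θ) = c * Complex.exp (σ * θ * Complex.I)) :
    (u (2 * Real.pi) - u 0).im = σ * (2 * Real.pi) := by
  have hv : ∀ θ : ℝ, Complex.exp (u θ - σ * θ * Complex.I) = c := fun θ => by
    rw [Complex.exp_sub, h]
    field_simp [Complex.exp_ne_zero]
  have key := eq_of_continuous_of_forall_exists_int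
    (f := fun θ : ℝ => ((u θ - σ * θ * Complex.I) - (u 0 - σ * (0 : ℝ) * Complex.I)).im /
      (2 * Real.pi)) (by fun_prop)
    (fun θ => exists_int_im_sub_of_exp_eq ((hv θ).trans (hv 0).symm)) (2 * Real.pi) 0
  have := Real.pi_pos
  field_simp at key
  simp at key ⊢
  linarith

/-- A homeomorphism that agrees with a reflection on a half-plane is not isotopic to the
identity: the winding number of the image of a small circle about the image of its centre
would have to jump. -/
theorem not_isotopicToIdentity_of_eq_reflection {h : (ℝ × ℝ) ≃ₜ (ℝ × ℝ)}
    (hR : ∀ x y, 2 ≤ x → h (x, y) = (-x, y)) : ¬ IsotopicToIdentity h := by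
  rintro ⟨F, hF, hinj, h0, h1⟩
  have hdiff : Continuous fun p : ℝ × ℝ =>
      F p.1 (3 + Real.cos p.2 / 2, Real.sin p.2 / 2) - F p.1 (3, 0) := by
    refine Continuous.sub ?_ ?_
    · exact hF.comp (f := fun p : ℝ × ℝ => (p.1, (3 + Real.cos p.2 / 2, Real.sin p.2 / 2)))
        (by fun_prop)
    · exact hF.comp (f := fun p : ℝ × ℝ => (p.1, ((3 : ℝ), (0 : ℝ)))) (by fun_prop)
  let G : C(ℝ × ℝ, ℂ) := ⟨fun p => Complex.equivRealProdCLM.symm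
      (F p.1 (3 + Real.cos p.2 / 2, Real.sin p.2 / 2) - F p.1 (3, 0)),
    Complex.equivRealProdCLM.symm.continuous.comp hdiff⟩
  have hG : ∀ p, G p ≠ 0 := by
    intro p hp
    obtain ⟨g, hg⟩ := hinj p.1
    have h2 := Complex.equivRealProdCLM.symm.map_eq_zero_iff.1 hp
    rw [sub_eq_zero, ← hg] at h2
    have h3 := g.injective h2
    simp only [Prod.mk.injEq] at h3
    have := Real.sin_sq_add_cos_sq p.2
    nlinarith
  obtain ⟨L, ⟨-, hL⟩, -⟩ := Complex.isCoveringMapOn_exp.existsUnique_continuousMap_lifts G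
    (a₀ := (0, 0)) (e₀ := Complex.log (G (0, 0))) (Complex.exp_log (hG _)) hG
  replace hL : ∀ p, Complex.exp (L p) = G p := fun p => congrFun hL p
  have hcont := eq_of_continuous_of_forall_exists_int
    (f := fun t => (L (t, 2 * Real.pi) - L (t, 0)).im / (2 * Real.pi)) (by fun_prop)
    (fun t => exists_int_im_sub_of_exp_eq (by
      rw [hL, hL]
      simp [G])) 0 1
  have e0 := im_sub_of_exp_eq_mul_exp (u := fun θ => L (0, θ)) (by fun_prop) (1 / 2) 1 (fun θ => by
    rw [hL]
    apply Complex.ext <;> simp [G, h0, Complex.exp_re, Complex.exp_im] <;> ring)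
  have e1 := im_sub_of_exp_eq_mul_exp (u := fun θ => L (1, θ)) (by fun_prop) (-1 / 2) (-1)
    (fun θ => by
      have hc := Real.neg_one_le_cos θ
      rw [hL]
      simp only [G, ContinuousMap.coe_mk, h1]
      rw [hR _ _ (by linarith), hR _ _ (by norm_num)]
      apply Complex.ext <;> simp [Complex.exp_re, Complex.exp_im] <;> ring)
  have := Real.pi_pos
  simp only [e0, e1] at hcont
  field_simp at hcont
  norm_num at hcont

/-- An open neighbourhood of the vertical axis that narrows at infinity. -/
def strip : Set (ℝ × ℝ) := {z | |z.1| * (1 + |z.2|) < 1}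

/-- A homeomorphism of the plane onto `strip`. -/
noncomputable def chart (p : ℝ × ℝ) : ℝ × ℝ :=
  (p.2 / (1 + |p.2|), p.1 / (1 + |p.2| * |p.1|))

/-- The inverse of `chart` on `strip`. -/
noncomputable def chartInv (z : ℝ × ℝ) : ℝ × ℝ :=
  (z.2 * (1 - |z.1|) / (1 - |z.1| - |z.1| * |z.2|), z.1 / (1 - |z.1|))

theorem mem_strip {z : ℝ × ℝ} : z ∈ strip ↔ |z.1| * (1 + |z.2|) < 1 := Iff.rfl

theorem isOpen_strip : IsOpen strip :=
  isOpen_lt (by fun_prop) continuous_const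

theorem abs_fst_lt_one_of_mem_strip {z : ℝ × ℝ} (hz : z ∈ strip) : |z.1| < 1 := by
  have h1 := abs_nonneg z.1
  have h2 := abs_nonneg z.2
  rw [mem_strip] at hz
  nlinarith

theorem neg_fst_mem_strip {z : ℝ × ℝ} : (-z.1, z.2) ∈ strip ↔ z ∈ strip := by
  simp [mem_strip]

theorem continuous_chart : Continuous chart := by
  unfold chart
  refine Continuous.prodMk (Continuous.div₀ (by fun_prop) (by fun_prop) fun p => ?_)
    (Continuous.div₀ (by fun_prop) (by fun_prop) fun p => ?_) <;> positivity

theorem chart_mem_strip (p : ℝ × ℝ) : chart p ∈ strip := by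
  obtain ⟨t, s⟩ := p
  have ht := abs_nonneg t
  have hs := abs_nonneg s
  have h1 : (0 : ℝ) < 1 + |s| := by positivity
  have h2 : (0 : ℝ) < 1 + |s| * |t| := by positivity
  simp only [mem_strip, chart, abs_div, abs_of_pos h1, abs_of_pos h2]
  have : |s| / (1 + |s|) * (1 + |t| / (1 + |s| * |t|)) =
      (|s| * (1 + |s| * |t| + |t|)) / ((1 + |s|) * (1 + |s| * |t|)) := by
    field_simp
  rw [this, div_lt_one (by positivity)]
  nlinarith

theorem chartInv_chart (p : ℝ × ℝ) : chartInv (chart p) = p := by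
  obtain ⟨t, s⟩ := p
  have h1 : (0 : ℝ) < 1 + |s| := by positivity
  have h2 : (0 : ℝ) < 1 + |s| * |t| := by positivity
  have e1 : 1 - |s| / (1 + |s|) = 1 / (1 + |s|) := by
    field_simp
    ring
  have e2 : 1 / (1 + |s|) - |s| / (1 + |s|) * (|t| / (1 + |s| * |t|)) =
      1 / ((1 + |s|) * (1 + |s| * |t|)) := by
    field_simp
    ring
  simp only [chartInv, chart, abs_div, abs_of_pos h1, abs_of_pos h2, Prod.mk.injEq, e1, e2]
  constructor <;> field_simp

theorem chart_chartInv {z : ℝ × ℝ} (hz : z ∈ strip) : chart (chartInv z) = z := by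
  have hx := abs_fst_lt_one_of_mem_strip hz
  obtain ⟨x, y⟩ := z
  rw [mem_strip] at hz
  simp only at hx hz
  have h1 : 0 < 1 - |x| := by linarith
  have h2 : 0 < 1 - |x| - |x| * |y| := by linarith
  have e1 : 1 + |x| / (1 - |x|) = 1 / (1 - |x|) := by
    field_simp
    ring
  have e2 : 1 + |x| / (1 - |x|) * (|y| * (1 - |x|) / (1 - |x| - |x| * |y|)) =
      (1 - |x|) / (1 - |x| - |x| * |y|) := by
    field_simp
    ring
  simp only [chartInv, chart, abs_div, abs_mul, abs_of_pos h1, abs_of_pos h2, Prod.mk.injEq, e1, e2]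
  constructor <;> field_simp

theorem continuousOn_chartInv : ContinuousOn chartInv strip := by
  unfold chartInv
  refine ContinuousOn.prodMk (ContinuousOn.div (by fun_prop) (by fun_prop) fun z hz => ?_)
    (ContinuousOn.div (by fun_prop) (by fun_prop) fun z hz => ?_)
  · rw [mem_strip] at hz
    linarith
  · linarith [abs_fst_lt_one_of_mem_strip hz]

open scoped Classical in
/-- The glide `(t, s) ↦ (t + ε, -s + ρ t)` in the coordinates of `chart`, extended by the
reflection in the vertical axis. -/
noncomputable def glide (ε : ℝ) (ρ : ℝ → ℝ) (z : ℝ × ℝ) : ℝ × ℝ :=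
  if z ∈ strip then
    chart ((chartInv z).1 + ε, -(chartInv z).2 + ρ (chartInv z).1)
  else (-z.1, z.2)

theorem glide_of_notMem {ε : ℝ} {ρ : ℝ → ℝ} {z : ℝ × ℝ} (hz : z ∉ strip) :
    glide ε ρ z = (-z.1, z.2) := if_neg hz

theorem glide_chart (ε : ℝ) (ρ : ℝ → ℝ) (t s : ℝ) :
    glide ε ρ (chart (t, s)) = chart (t + ε, -s + ρ t) := by
  rw [glide, if_pos (chart_mem_strip _), chartInv_chart]

theorem exists_chart_eq {z : ℝ × ℝ} (hz : z ∈ strip) : ∃ t s, chart (t, s) = z :=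
  ⟨_, _, chart_chartInv hz⟩

theorem glide_glide (ε : ℝ) (ρ : ℝ → ℝ) (z : ℝ × ℝ) :
    glide (-ε) (fun t => ρ (t - ε)) (glide ε ρ z) = z := by
  by_cases hz : z ∈ strip
  · obtain ⟨t, s, rfl⟩ := exists_chart_eq hz
    simp [glide_chart]
  · rw [glide_of_notMem hz, glide_of_notMem (by rwa [neg_fst_mem_strip])]
    simp

theorem tendsto_chart_glide_boundary {ε M : ℝ} {ρ : ℝ → ℝ} (hM : ∀ t, |ρ t| ≤ M)
    (h0 : Tendsto ρ (Bornology.cobounded ℝ) (𝓝 0)) {z₀ : ℝ × ℝ} (hz₀ : z₀ ∉ strip) :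
    Tendsto (fun z => chart ((chartInv z).1 + ε, -(chartInv z).2 + ρ (chartInv z).1))
      (𝓝[strip] z₀) (𝓝 (-z₀.1, z₀.2)) := by
  obtain hbot | hne := eq_or_neBot (𝓝[strip] z₀)
  · rw [hbot]
    exact tendsto_bot
  have hfst : Tendsto (fun z : ℝ × ℝ => z.1) (𝓝[strip] z₀) (𝓝 z₀.1) :=
    continuous_fst.continuousAt.tendsto.mono_left nhdsWithin_le_nhds
  have hsnd : Tendsto (fun z : ℝ × ℝ => z.2) (𝓝[strip] z₀) (𝓝 z₀.2) :=
    continuous_snd.continuousAt.tendsto.mono_left nhdsWithin_le_nhds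
  have hmem : ∀ᶠ z in 𝓝[strip] z₀, z ∈ strip := self_mem_nhdsWithin
  have hden : Tendsto (fun z : ℝ × ℝ => 1 - |z.1| - |z.1| * |z.2|) (𝓝[strip] z₀)
      (𝓝 (1 - |z₀.1| - |z₀.1| * |z₀.2|)) :=
    ((tendsto_const_nhds.sub hfst.abs).sub (hfst.abs.mul hsnd.abs))
  have hden0 : 1 - |z₀.1| - |z₀.1| * |z₀.2| = 0 := by
    apply le_antisymm
    · rw [mem_strip] at hz₀
      linarith
    · refine ge_of_tendsto hden (hmem.mono fun z hz => ?_)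
      rw [mem_strip] at hz
      linarith
  rw [hden0] at hden
  have habs0 : |z₀.1| ≤ 1 :=
    le_of_tendsto hfst.abs (hmem.mono fun z hz => (abs_fst_lt_one_of_mem_strip hz).le)
  obtain hlt | heq := habs0.lt_or_eq
  · obtain ⟨σ, hσ, hσ0⟩ : ∃ σ : ℝ, |σ| = 1 ∧ |z₀.2| = σ * z₀.2 := by
      obtain h | h := le_total 0 z₀.2
      · exact ⟨1, by simp, by simp [abs_of_nonneg h]⟩
      · exact ⟨-1, by simp, by simp [abs_of_nonpos h]⟩
    have hσσ : σ * σ = 1 := by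
      rw [← abs_mul_abs_self, hσ, one_mul]
    have hx0 : 0 < |z₀.1| := by
      by_contra h
      have : |z₀.1| = 0 := le_antisymm (not_lt.1 h) (abs_nonneg _)
      simp [this] at hden0
    have hy0 : 0 < |z₀.2| := by
      by_contra h
      have : |z₀.2| = 0 := le_antisymm (not_lt.1 h) (abs_nonneg _)
      rw [this] at hden0
      linarith
    have hs : Tendsto (fun z => (chartInv z).2) (𝓝[strip] z₀) (𝓝 (z₀.1 / (1 - |z₀.1|))) :=
      hfst.div (tendsto_const_nhds.sub hfst.abs) (by linarith)
    have ht : Tendsto (fun z => σ * (chartInv z).1) (𝓝[strip] z₀) atTop := by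
      have hnum : Tendsto (fun z : ℝ × ℝ => σ * (z.2 * (1 - |z.1|))) (𝓝[strip] z₀)
          (𝓝 (σ * (z₀.2 * (1 - |z₀.1|)))) :=
        tendsto_const_nhds.mul (hsnd.mul (tendsto_const_nhds.sub hfst.abs))
      have hinv : Tendsto (fun z : ℝ × ℝ => (1 - |z.1| - |z.1| * |z.2|)⁻¹) (𝓝[strip] z₀) atTop := by
        refine tendsto_inv_nhdsGT_zero.comp
          (tendsto_nhdsWithin_iff.2 ⟨hden, hmem.mono fun z hz => ?_⟩)
        rw [mem_strip] at hz
        simp only [Set.mem_Ioi]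
        linarith
      refine (hnum.pos_mul_atTop ?_ hinv).congr fun z => ?_
      · rw [← mul_assoc, ← hσ0]
        exact mul_pos hy0 (by linarith)
      · simp only [chartInv]
        ring
    have hρ : Tendsto (fun z => ρ (chartInv z).1) (𝓝[strip] z₀) (𝓝 0) := by
      refine h0.comp (tendsto_norm_atTop_iff_cobounded.1 ?_)
      refine tendsto_atTop_mono (fun z => ?_) ht
      calc σ * (chartInv z).1 ≤ |σ * (chartInv z).1| := le_abs_self _
        _ = _ := by rw [abs_mul, hσ, one_mul, Real.norm_eq_abs]
    have hs' : Tendsto (fun z => -(chartInv z).2 + ρ (chartInv z).1) (𝓝[strip] z₀)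
        (𝓝 (-(z₀.1 / (1 - |z₀.1|)))) := by
      simpa using hs.neg.add hρ
    have h1 : 0 < 1 - |z₀.1| := by linarith
    have ht' : Tendsto (fun z => σ * ((chartInv z).1 + ε)) (𝓝[strip] z₀) atTop := by
      simp only [mul_add]
      exact tendsto_atTop_add_const_right _ _ ht
    have habs' : |-(z₀.1 / (1 - |z₀.1|))| = |z₀.1| / (1 - |z₀.1|) := by
      rw [abs_neg, abs_div, abs_of_pos h1]
    refine Tendsto.prodMk_nhds ?_ ?_
    · have hlim : -z₀.1 = -(z₀.1 / (1 - |z₀.1|)) / (1 + |-(z₀.1 / (1 - |z₀.1|))|) := by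
        rw [habs']
        field_simp
        ring
      rw [hlim]
      exact hs'.div (tendsto_const_nhds.add hs'.abs) (by positivity)
    · have hlim : z₀.2 = σ / (0 + |-(z₀.1 / (1 - |z₀.1|))|) := by
        rw [habs']
        have : |z₀.1| * (σ * z₀.2) = 1 - |z₀.1| := by
          rw [← hσ0]
          linarith
        field_simp
        rw [← this]
        linear_combination (-(|z₀.1| * z₀.2)) * hσσ
      rw [hlim]
      refine Tendsto.congr' ?_ ((tendsto_const_nhds (x := σ)).div
        ((tendsto_inv_atTop_zero.comp ht').add hs'.abs) ?_)
      · filter_upwards [ht'.eventually_gt_atTop 0] with z hz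
        have habs : |(chartInv z).1 + ε| = σ * ((chartInv z).1 + ε) := by
          rw [← abs_of_pos hz, abs_mul, hσ, one_mul]
        have hσn : σ ≠ 0 := by
          rintro rfl
          simp at hσ
        have hn : (chartInv z).1 + ε ≠ 0 := by
          intro h
          simp [h] at hz
        simp only [Function.comp_apply, Pi.div_apply, habs]
        have : 0 ≤ |-(chartInv z).2 + ρ (chartInv z).1| := abs_nonneg _
        generalize |-(chartInv z).2 + ρ (chartInv z).1| = S at *
        generalize (chartInv z).1 + ε = T at *
        rw [div_eq_div_iff (by positivity) (by positivity)]
        field_simp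
        linear_combination hσσ * (1 + S * (σ * T))
      · rw [habs', zero_add]
        positivity
  · obtain ⟨σ, hσ, hσ0⟩ : ∃ σ : ℝ, |σ| = 1 ∧ z₀.1 = σ := ⟨_, heq, rfl⟩
    have hσσ : σ * σ = 1 := by
      rw [← abs_mul_abs_self, hσ, one_mul]
    have hy0 : z₀.2 = 0 := by
      rw [heq] at hden0
      simpa using hden0
    have hs : Tendsto (fun z => σ * (chartInv z).2) (𝓝[strip] z₀) atTop := by
      have hnum : Tendsto (fun z : ℝ × ℝ => σ * z.1) (𝓝[strip] z₀) (𝓝 (σ * z₀.1)) :=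
        tendsto_const_nhds.mul hfst
      have hinv : Tendsto (fun z : ℝ × ℝ => (1 - |z.1|)⁻¹) (𝓝[strip] z₀) atTop := by
        refine tendsto_inv_nhdsGT_zero.comp
          (tendsto_nhdsWithin_iff.2 ⟨?_, hmem.mono fun z hz => ?_⟩)
        · simpa [heq] using (tendsto_const_nhds (x := (1 : ℝ))).sub hfst.abs
        · simpa using abs_fst_lt_one_of_mem_strip hz
      refine (hnum.pos_mul_atTop ?_ hinv).congr fun z => ?_
      · rw [hσ0, hσσ]
        exact one_pos
      · simp only [chartInv]
        ring
    have hs' : Tendsto (fun z => -σ * (-(chartInv z).2 + ρ (chartInv z).1)) (𝓝[strip] z₀)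
        atTop := by
      refine tendsto_atTop_mono (fun z => ?_) (tendsto_atTop_add_const_right _ (-M) hs)
      have h1 : σ * ρ (chartInv z).1 ≤ M := by
        refine (le_abs_self _).trans ?_
        rw [abs_mul, hσ, one_mul]
        exact hM _
      linarith
    have habs : ∀ᶠ z in 𝓝[strip] z₀, |-(chartInv z).2 + ρ (chartInv z).1| =
        -σ * (-(chartInv z).2 + ρ (chartInv z).1) := by
      filter_upwards [hs'.eventually_gt_atTop 0] with z hz
      rw [← abs_of_pos hz, abs_mul, abs_neg, hσ, one_mul]
    have hS : Tendsto (fun z => |-(chartInv z).2 + ρ (chartInv z).1|) (𝓝[strip] z₀) atTop :=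
      hs'.congr' (habs.mono fun z hz => hz.symm)
    refine Tendsto.prodMk_nhds ?_ ?_
    · have hlim : -z₀.1 = -σ * (1 - 0) := by
        rw [hσ0]
        ring
      rw [hlim]
      refine Tendsto.congr' ?_ (tendsto_const_nhds.mul (tendsto_const_nhds.sub
        (tendsto_inv_atTop_zero.comp (tendsto_atTop_add_const_left _ 1 hS))))
      filter_upwards [habs] with z hz
      have : 0 ≤ |-(chartInv z).2 + ρ (chartInv z).1| := abs_nonneg _
      simp only [Function.comp_apply]
      generalize -(chartInv z).2 + ρ (chartInv z).1 = u at *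
      field_simp
      rw [hz]
      linear_combination (u) * hσσ
    · rw [hy0]
      refine squeeze_zero_norm' ?_ (tendsto_inv_atTop_zero.comp hS)
      filter_upwards [hS.eventually_gt_atTop 0] with z hz
      simp only [Function.comp_apply, Real.norm_eq_abs, abs_div]
      generalize |-(chartInv z).2 + ρ (chartInv z).1| = u at *
      have h3 := abs_nonneg ((chartInv z).1 + ε)
      generalize |(chartInv z).1 + ε| = T at *
      rw [abs_of_pos (by positivity), div_le_iff₀ (by positivity)]
      field_simp
      linarith

theorem continuous_glide {ε M : ℝ} {ρ : ℝ → ℝ} (hρ : Continuous ρ) (hM : ∀ t, |ρ t| ≤ M)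
    (h0 : Tendsto ρ (Bornology.cobounded ℝ) (𝓝 0)) : Continuous (glide ε ρ) := by
  classical
  refine continuous_iff_continuousAt.2 fun z₀ => ?_
  by_cases hz₀ : z₀ ∈ strip
  · have hnhds := isOpen_strip.mem_nhds hz₀
    have hinv : ContinuousAt chartInv z₀ := continuousOn_chartInv.continuousAt hnhds
    refine ContinuousAt.congr (f := fun z =>
      chart ((chartInv z).1 + ε, -(chartInv z).2 + ρ (chartInv z).1)) ?_ ?_
    · have hg : Continuous fun q : ℝ × ℝ => chart (q.1 + ε, -q.2 + ρ q.1) :=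
        continuous_chart.comp (by fun_prop)
      exact hg.continuousAt.comp hinv
    · filter_upwards [hnhds] with z hz
      rw [glide, if_pos hz]
  · rw [ContinuousAt, glide_of_notMem hz₀]
    refine Tendsto.if (tendsto_chart_glide_boundary hM h0 hz₀) ?_
    have : Continuous fun z : ℝ × ℝ => (-z.1, z.2) := by fun_prop
    exact this.continuousAt.tendsto.mono_left inf_le_left

/-- The map `glide ε ρ` as a homeomorphism of the plane. -/
noncomputable def glideHomeomorph (ε M : ℝ) (ρ : ℝ → ℝ) (hρ : Continuous ρ)
    (hM : ∀ t, |ρ t| ≤ M) (h0 : Tendsto ρ (Bornology.cobounded ℝ) (𝓝 0)) :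
    (ℝ × ℝ) ≃ₜ (ℝ × ℝ) where
  toFun := glide ε ρ
  invFun := glide (-ε) fun t => ρ (t - ε)
  left_inv := glide_glide ε ρ
  right_inv z := by
    simpa using glide_glide (-ε) (fun t => ρ (t - ε)) z
  continuous_toFun := continuous_glide hρ hM h0
  continuous_invFun := continuous_glide (hρ.comp (continuous_sub_right ε)) (fun t => hM _)
    (h0.comp (tendsto_sub_const_cobounded ε))

/-- An oscillating function that is unbounded along every orbit of a unit translation, while
`height t + height (t + 1)` vanishes at infinity. -/
noncomputable def height (t : ℝ) : ℝ :=
  √(1 + |t|) * Real.cos (Real.pi * t) + √√(1 + |t|) * Real.sin (Real.pi * t)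

theorem continuous_height : Continuous height := by
  unfold height
  fun_prop

theorem one_le_sqrt_one_add_abs (t : ℝ) : 1 ≤ √(1 + |t|) :=
  Real.one_le_sqrt.2 (by linarith [abs_nonneg t])

theorem abs_sqrt_sub_sqrt_le {a b : ℝ} (ha : 0 < a) (hb : 0 ≤ b) :
    |√b - √a| ≤ |b - a| / √a := by
  have h1 : 0 < √a := Real.sqrt_pos.2 ha
  have h2 : 0 ≤ √b := Real.sqrt_nonneg b
  have h3 : b - a = (√b - √a) * (√b + √a) := by
    linear_combination Real.sq_sqrt ha.le - Real.sq_sqrt hb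
  rw [le_div_iff₀ h1, h3, abs_mul, abs_of_pos (show 0 < √b + √a by positivity)]
  exact mul_le_mul_of_nonneg_left (by linarith) (abs_nonneg _)

theorem abs_height_add_height_le (t : ℝ) : |height t + height (t + 1)| ≤ 2 / √(1 + |t|) := by
  have hA := one_le_sqrt_one_add_abs t
  have hA' := one_le_sqrt_one_add_abs (t + 1)
  have h1 : |√(1 + |t + 1|) - √(1 + |t|)| ≤ 1 / √(1 + |t|) := by
    refine (abs_sqrt_sub_sqrt_le (by positivity) (by positivity)).trans ?_
    gcongr
    have := abs_abs_sub_abs_le_abs_sub (t + 1) t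
    simpa using this
  have h2 : |√√(1 + |t + 1|) - √√(1 + |t|)| ≤ 1 / √(1 + |t|) := by
    refine (abs_sqrt_sub_sqrt_le (by positivity) (by positivity)).trans (le_trans ?_ h1)
    exact div_le_self (abs_nonneg _) (Real.one_le_sqrt.2 hA)
  have h3 : height t + height (t + 1) =
      -((√(1 + |t + 1|) - √(1 + |t|)) * Real.cos (Real.pi * t) +
        (√√(1 + |t + 1|) - √√(1 + |t|)) * Real.sin (Real.pi * t)) := by
    simp only [height, mul_add, mul_one, Real.cos_add_pi, Real.sin_add_pi]
    ring
  rw [h3, abs_neg]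
  refine (abs_add_le _ _).trans ?_
  rw [abs_mul, abs_mul]
  have h4 := mul_le_mul h1 (Real.abs_cos_le_one (Real.pi * t)) (abs_nonneg _) (by positivity)
  have h5 := mul_le_mul h2 (Real.abs_sin_le_one (Real.pi * t)) (abs_nonneg _) (by positivity)
  calc _ ≤ 1 / √(1 + |t|) * 1 + 1 / √(1 + |t|) * 1 := add_le_add h4 h5
    _ = _ := by ring

theorem abs_height_add_height_le_two (t : ℝ) : |height t + height (t + 1)| ≤ 2 :=
  (abs_height_add_height_le t).trans (div_le_self zero_le_two (one_le_sqrt_one_add_abs t))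

theorem tendsto_height_add_height :
    Tendsto (fun t => height t + height (t + 1)) (Bornology.cobounded ℝ) (𝓝 0) := by
  refine squeeze_zero_norm abs_height_add_height_le ?_
  exact Tendsto.const_div_atTop (Real.tendsto_sqrt_atTop.comp
    (tendsto_atTop_add_const_left _ 1 tendsto_norm_cobounded_atTop)) 2

theorem tendsto_abs_add_quadratic {B : ℕ → ℝ} (hB : Tendsto B atTop atTop) {α β : ℝ}
    (h : α ^ 2 + β ^ 2 = 1) (c : ℝ) :
    Tendsto (fun n => |c + (B n ^ 2 * α + B n * β)|) atTop atTop := by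
  obtain ⟨σ, hσ, hlim⟩ : ∃ σ : ℝ, |σ| = 1 ∧
      Tendsto (fun n => σ * (B n ^ 2 * α + B n * β)) atTop atTop := by
    obtain rfl | hα := eq_or_ne α 0
    · refine ⟨β, ?_, hB.congr fun n => ?_⟩
      · rw [← pow_eq_one_iff_of_nonneg (abs_nonneg β) two_ne_zero, sq_abs]
        linarith
      · linear_combination -(B n) * h
    · refine ⟨α / |α|, by rw [abs_div, abs_abs, div_self (abs_ne_zero.2 hα)], ?_⟩
      have := hB.atTop_mul_atTop₀ (tendsto_atTop_add_const_right _ (α / |α| * β)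
        (hB.const_mul_atTop (abs_pos.2 hα)))
      refine this.congr fun n => ?_
      have h1 : α / |α| * α = |α| := by
        rw [div_mul_eq_mul_div, ← abs_mul_abs_self, mul_self_div_self]
      linear_combination -(B n) ^ 2 * h1
  refine tendsto_atTop_mono (fun n => ?_) (tendsto_atTop_add_const_right _ (-|c|) hlim)
  have h1 : σ * (B n ^ 2 * α + B n * β) ≤ |B n ^ 2 * α + B n * β| := by
    refine (le_abs_self _).trans ?_
    rw [abs_mul, hσ, one_mul]
  have h2 := abs_sub (c + (B n ^ 2 * α + B n * β)) c
  rw [add_sub_cancel_left] at h2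
  linarith

theorem tendsto_abs_add_height {ε : ℝ} (hε : ε = 1 ∨ ε = -1) (t c : ℝ) :
    Tendsto (fun n : ℕ => |(-1) ^ n * c + height (t + ε * n)|) atTop atTop := by
  have habs : |ε| = 1 := by
    obtain rfl | rfl := hε <;> simp
  have hB : Tendsto (fun n : ℕ => √√(1 + |t + ε * n|)) atTop atTop := by
    refine Real.tendsto_sqrt_atTop.comp (Real.tendsto_sqrt_atTop.comp ?_)
    refine tendsto_atTop_mono (fun n => ?_)
      (tendsto_atTop_add_const_right _ (-|t|) tendsto_natCast_atTop_atTop)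
    have h := abs_sub (t + ε * n) t
    rw [add_sub_cancel_left, abs_mul, habs, one_mul, Nat.abs_cast] at h
    linarith
  refine (tendsto_abs_add_quadratic hB (Real.cos_sq_add_sin_sq (Real.pi * t)) c).congr fun n => ?_
  have hcos : Real.cos (Real.pi * (t + ε * n)) = (-1) ^ n * Real.cos (Real.pi * t) := by
    obtain rfl | rfl := hε
    · rw [← Real.cos_add_nat_mul_pi]
      ring_nf
    · rw [← Real.cos_sub_nat_mul_pi]
      ring_nf
  have hsin : Real.sin (Real.pi * (t + ε * n)) = (-1) ^ n * Real.sin (Real.pi * t) := by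
    obtain rfl | rfl := hε
    · rw [← Real.sin_add_nat_mul_pi]
      ring_nf
    · rw [← Real.sin_sub_nat_mul_pi]
      ring_nf
  rw [height, hcos, hsin, Real.sq_sqrt (Real.sqrt_nonneg _)]
  have : (-1) ^ n * c + (√(1 + |t + ε * n|) * ((-1) ^ n * Real.cos (Real.pi * t)) +
      √√(1 + |t + ε * n|) * ((-1) ^ n * Real.sin (Real.pi * t))) =
      (-1) ^ n * (c + (√(1 + |t + ε * n|) * Real.cos (Real.pi * t) +
        √√(1 + |t + ε * n|) * Real.sin (Real.pi * t))) := by ring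
  rw [this, abs_mul, abs_pow, abs_neg, abs_one, one_pow, one_mul]

theorem isBounded_range_of_eventually_norm_le {E : Type*} [SeminormedAddCommGroup E] {u : ℕ → E}
    {M : ℝ} (h : ∀ᶠ n in atTop, ‖u n‖ ≤ M) : Bornology.IsBounded (Set.range u) := by
  obtain ⟨N, hN⟩ := eventually_atTop.1 h
  refine (((Set.finite_Iio N).image u).isBounded.union
    (Metric.isBounded_closedBall (x := (0 : E)) (r := M))).subset ?_
  rintro _ ⟨n, rfl⟩
  obtain hn | hn := lt_or_ge n N
  · exact Or.inl ⟨n, hn, rfl⟩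
  · exact Or.inr (mem_closedBall_zero_iff.2 (hN n hn))

theorem abs_chart_fst_le (t s : ℝ) : |(chart (t, s)).1| ≤ 1 := by
  have h : 0 < 1 + |s| := by positivity
  rw [chart, abs_div, abs_of_pos h, div_le_one h]
  simp

theorem abs_chart_snd_le {t s : ℝ} (hs : 1 ≤ |s|) : |(chart (t, s)).2| ≤ 1 := by
  have h : 0 < 1 + |s| * |t| := by positivity
  rw [chart, abs_div, abs_of_pos h, div_le_one h]
  simp only
  nlinarith [abs_nonneg t]

theorem iterate_chart {f : ℝ × ℝ → ℝ × ℝ} {ε : ℝ}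
    (hf : ∀ t s, f (chart (t, s)) = chart (t + ε, -s + (height t + height (t + ε))))
    (t s : ℝ) (n : ℕ) : f^[n] (chart (t, s)) =
      chart (t + ε * n, (-1) ^ n * (s - height t) + height (t + ε * n)) := by
  induction n with
  | zero => simp
  | succ n ih =>
    rw [Function.iterate_succ_apply', ih, hf]
    have : t + ε * n + ε = t + ε * (n + 1 : ℕ) := by
      push_cast
      ring
    rw [this]
    congr 2
    ring

theorem isBounded_range_iterate {f : ℝ × ℝ → ℝ × ℝ} {ε : ℝ} (hε : ε = 1 ∨ ε = -1)
    (hf : ∀ t s, f (chart (t, s)) = chart (t + ε, -s + (height t + height (t + ε))))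
    {z : ℝ × ℝ} (hz : z ∈ strip) : Bornology.IsBounded (Set.range fun n => f^[n] z) := by
  obtain ⟨t, s, rfl⟩ := exists_chart_eq hz
  refine isBounded_range_of_eventually_norm_le (M := 1) ?_
  filter_upwards [(tendsto_abs_add_height hε t (s - height t)).eventually_ge_atTop 1] with n hn
  rw [iterate_chart hf, Prod.norm_def]
  exact max_le (abs_chart_fst_le _ _) (abs_chart_snd_le hn)

/-- The squared distance to the point `(-3, 0)`. -/
def sqDist (z : ℝ × ℝ) : ℝ := (z.1 + 3) ^ 2 + z.2 ^ 2

/-- The rotation angle of the twist on the circle of squared radius `q`. -/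
noncomputable def twistAngle (q : ℝ) : ℝ := 2 * Real.pi * max 0 (1 - q)

/-- A twist of the unit disc centred at `(-3, 0)`, with speed `σ`. -/
noncomputable def twist (σ : ℝ) (z : ℝ × ℝ) : ℝ × ℝ :=
  (-3 + ((z.1 + 3) * Real.cos (σ * twistAngle (sqDist z)) -
      z.2 * Real.sin (σ * twistAngle (sqDist z))),
    (z.1 + 3) * Real.sin (σ * twistAngle (sqDist z)) +
      z.2 * Real.cos (σ * twistAngle (sqDist z)))

theorem sqDist_twist (σ : ℝ) (z : ℝ × ℝ) : sqDist (twist σ z) = sqDist z := by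
  have h := Real.sin_sq_add_cos_sq (σ * twistAngle (sqDist z))
  rw [sqDist, twist]
  generalize Real.cos (σ * twistAngle (sqDist z)) = a at *
  generalize Real.sin (σ * twistAngle (sqDist z)) = b at *
  rw [sqDist]
  linear_combination ((z.1 + 3) ^ 2 + z.2 ^ 2) * h

theorem twist_neg_twist (σ : ℝ) (z : ℝ × ℝ) : twist (-σ) (twist σ z) = z := by
  have h := Real.sin_sq_add_cos_sq (σ * twistAngle (sqDist z))
  rw [twist, sqDist_twist, neg_mul, Real.cos_neg, Real.sin_neg, twist]
  generalize Real.cos (σ * twistAngle (sqDist z)) = a at *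
  generalize Real.sin (σ * twistAngle (sqDist z)) = b at *
  ext
  · simp only
    linear_combination (z.1 + 3) * h
  · simp only
    linear_combination z.2 * h

theorem continuous_twist (σ : ℝ) : Continuous (twist σ) := by
  unfold twist twistAngle sqDist
  fun_prop

/-- The twist as a homeomorphism of the plane. -/
noncomputable def twistHomeomorph (σ : ℝ) : (ℝ × ℝ) ≃ₜ (ℝ × ℝ) where
  toFun := twist σ
  invFun := twist (-σ)
  left_inv := twist_neg_twist σ
  right_inv z := by simpa using twist_neg_twist (-σ) z
  continuous_toFun := continuous_twist σ
  continuous_invFun := continuous_twist (-σ)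

theorem twist_of_one_le {σ : ℝ} {z : ℝ × ℝ} (hz : 1 ≤ sqDist z) : twist σ z = z := by
  simp [twist, twistAngle, max_eq_left (sub_nonpos.2 hz)]

theorem bounds_of_sqDist_lt_one {z : ℝ × ℝ} (hz : sqDist z < 1) :
    -4 < z.1 ∧ z.1 < -2 ∧ |z.2| < 1 := by
  rw [sqDist] at hz
  refine ⟨by nlinarith [sq_nonneg z.2], by nlinarith [sq_nonneg z.2], ?_⟩
  rw [abs_lt]
  constructor <;> nlinarith [sq_nonneg (z.1 + 3)]

theorem twist_of_neg_two_le {σ : ℝ} {z : ℝ × ℝ} (hz : -2 ≤ z.1) : twist σ z = z := by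
  refine twist_of_one_le (not_lt.1 fun h => ?_)
  linarith [bounds_of_sqDist_lt_one h]

theorem notMem_strip_of_sqDist_lt_one {z : ℝ × ℝ} (hz : sqDist z < 1) : z ∉ strip := by
  intro h
  have h1 := abs_lt.1 (abs_fst_lt_one_of_mem_strip h)
  linarith [bounds_of_sqDist_lt_one hz]

theorem twist_mem_of_disc_subset {σ : ℝ} {s : Set (ℝ × ℝ)}
    (hs : ∀ z, sqDist z < 1 → z ∈ s) {z : ℝ × ℝ} (hz : z ∈ s) : twist σ z ∈ s := by
  obtain h | h := lt_or_ge (sqDist z) 1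
  · exact hs _ (by rwa [sqDist_twist])
  · rwa [twist_of_one_le h]

theorem twist_of_mem_strip {σ : ℝ} {z : ℝ × ℝ} (hz : z ∈ strip) : twist σ z = z :=
  twist_of_neg_two_le (by linarith [abs_lt.1 (abs_fst_lt_one_of_mem_strip hz)])

theorem twist_notMem_strip {σ : ℝ} {z : ℝ × ℝ} (hz : z ∉ strip) : twist σ z ∉ strip :=
  twist_mem_of_disc_subset (s := stripᶜ) (fun _ h => notMem_strip_of_sqDist_lt_one h) hz

/-- The twist followed by the glide on `strip`. -/
noncomputable def twistGlide : (ℝ × ℝ) ≃ₜ (ℝ × ℝ) :=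
  (twistHomeomorph 1).trans (glideHomeomorph 1 2 (fun t => height t + height (t + 1))
    (continuous_height.add (continuous_height.comp (continuous_add_const 1)))
    abs_height_add_height_le_two tendsto_height_add_height)

theorem twistGlide_apply (z : ℝ × ℝ) :
    twistGlide z = glide 1 (fun t => height t + height (t + 1)) (twist 1 z) := rfl

theorem twistGlide_symm_apply (z : ℝ × ℝ) : twistGlide.symm z =
    twist (-1) (glide (-1) (fun t => height (t - 1) + height (t - 1 + 1)) z) := rfl

theorem twistGlide_chart (t s : ℝ) :
    twistGlide (chart (t, s)) = chart (t + 1, -s + (height t + height (t + 1))) := by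
  rw [twistGlide_apply, twist_of_mem_strip (chart_mem_strip _), glide_chart]

theorem twistGlide_symm_chart (t s : ℝ) :
    twistGlide.symm (chart (t, s)) = chart (t + -1, -s + (height t + height (t + -1))) := by
  rw [twistGlide_symm_apply, glide_chart, twist_of_mem_strip (chart_mem_strip _),
    sub_add_cancel, add_comm (height (t - 1)), sub_eq_add_neg]

theorem twistGlide_of_notMem {z : ℝ × ℝ} (hz : z ∉ strip) :
    twistGlide z = (-(twist 1 z).1, (twist 1 z).2) := by
  rw [twistGlide_apply, glide_of_notMem (twist_notMem_strip hz)]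

theorem twistGlide_symm_of_notMem {z : ℝ × ℝ} (hz : z ∉ strip) :
    twistGlide.symm z = twist (-1) (-z.1, z.2) := by
  rw [twistGlide_symm_apply, glide_of_notMem hz]

theorem notMem_strip_of_one_le {z : ℝ × ℝ} (hz : 1 ≤ |z.1|) : z ∉ strip := fun h =>
  absurd (abs_fst_lt_one_of_mem_strip h) hz.not_gt

theorem not_isotopicToIdentity_twistGlide : ¬ IsotopicToIdentity twistGlide := by
  refine not_isotopicToIdentity_of_eq_reflection fun x y hx => ?_
  rw [twistGlide_of_notMem, twist_of_neg_two_le]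
  · simp only
    linarith
  · exact notMem_strip_of_one_le ((by linarith : (1 : ℝ) ≤ x).trans (le_abs_self x))

theorem twistGlide_ne_self (z : ℝ × ℝ) : twistGlide z ≠ z := by
  by_cases hz : z ∈ strip
  · obtain ⟨t, s, rfl⟩ := exists_chart_eq hz
    intro h
    rw [twistGlide_chart] at h
    have := congrArg (fun w => (chartInv w).1) h
    simp [chartInv_chart] at this
  · rw [twistGlide_of_notMem hz]
    intro h
    obtain h1 | h1 := lt_or_ge (sqDist z) 1
    · have h2 := bounds_of_sqDist_lt_one h1
      have h3 := bounds_of_sqDist_lt_one ((sqDist_twist 1 z).trans_lt h1)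
      have := congrArg Prod.fst h
      simp only at this
      linarith
    · rw [twist_of_one_le h1] at h
      have := congrArg Prod.fst h
      simp only at this
      have h0 : z.1 = 0 := by linarith
      exact hz (by simp [mem_strip, h0])

theorem isBounded_range_iterate_of_mapsTo {f : ℝ × ℝ → ℝ × ℝ}
    (hf : ∀ M, 4 ≤ M → Set.MapsTo f {z | z ∉ strip ∧ |z.1| ≤ M ∧ |z.2| ≤ M}
      {z | z ∉ strip ∧ |z.1| ≤ M ∧ |z.2| ≤ M}) {z : ℝ × ℝ} (hz : z ∉ strip) :
    Bornology.IsBounded (Set.range fun n => f^[n] z) := by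
  have hM := (hf (max 4 ‖z‖) (le_max_left _ _)).iterate
  have hz' : z ∈ {w : ℝ × ℝ | w ∉ strip ∧ |w.1| ≤ max 4 ‖z‖ ∧ |w.2| ≤ max 4 ‖z‖} :=
    ⟨hz, (norm_fst_le z).trans (le_max_right _ _), (norm_snd_le z).trans (le_max_right _ _)⟩
  refine isBounded_range_of_eventually_norm_le (M := max 4 ‖z‖) (.of_forall fun n => ?_)
  obtain ⟨-, h1, h2⟩ := hM n hz'
  exact max_le h1 h2

theorem twist_mapsTo {σ M : ℝ} (hM : 4 ≤ M) :
    Set.MapsTo (twist σ) {z | z ∉ strip ∧ |z.1| ≤ M ∧ |z.2| ≤ M}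
      {z | z ∉ strip ∧ |z.1| ≤ M ∧ |z.2| ≤ M} := by
  refine fun z hz => twist_mem_of_disc_subset (fun w hw => ?_) hz
  have h := bounds_of_sqDist_lt_one hw
  exact ⟨notMem_strip_of_sqDist_lt_one hw, abs_le.2 ⟨by linarith, by linarith⟩, by linarith⟩

theorem isBounded_range_iterate_twistGlide (z : ℝ × ℝ) :
    Bornology.IsBounded (Set.range fun n => (⇑twistGlide)^[n] z) := by
  by_cases hz : z ∈ strip
  · exact isBounded_range_iterate (Or.inl rfl) twistGlide_chart hz
  · refine isBounded_range_iterate_of_mapsTo (fun M hM w hw => ?_) hz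
    obtain ⟨h1, h2, h3⟩ := twist_mapsTo (σ := 1) hM hw
    rw [twistGlide_of_notMem hw.1]
    exact ⟨by rwa [neg_fst_mem_strip], by simpa using h2, h3⟩

theorem isBounded_range_iterate_twistGlide_symm (z : ℝ × ℝ) :
    Bornology.IsBounded (Set.range fun n => (⇑twistGlide.symm)^[n] z) := by
  by_cases hz : z ∈ strip
  · exact isBounded_range_iterate (Or.inr rfl) twistGlide_symm_chart hz
  · refine isBounded_range_iterate_of_mapsTo (fun M hM w hw => ?_) hz
    rw [twistGlide_symm_of_notMem hw.1]
    exact twist_mapsTo hM ⟨by rw [neg_fst_mem_strip]; exact hw.1, by simpa using hw.2.1, hw.2.2⟩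

theorem twistGlide_iterate_two_mul {r φ : ℝ} (hr : r ^ 2 < 1)
    (hφ : φ = 2 * Real.pi * (1 - r ^ 2)) (j : ℕ) :
    (⇑twistGlide)^[2 * j] (-3 + r, 0) =
      (-3 + r * Real.cos (j * φ), r * Real.sin (j * φ)) := by
  induction j with
  | zero => simp
  | succ j ih =>
    have hq : sqDist (-3 + r * Real.cos (j * φ), r * Real.sin (j * φ)) = r ^ 2 := by
      rw [sqDist]
      linear_combination r ^ 2 * Real.sin_sq_add_cos_sq (j * φ)
    have hangle : 1 * twistAngle (r ^ 2) = φ := by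
      rw [twistAngle, max_eq_right (by linarith), hφ, one_mul]
    have hstep : twist 1 (-3 + r * Real.cos (j * φ), r * Real.sin (j * φ)) =
        (-3 + r * Real.cos ((j + 1 : ℕ) * φ), r * Real.sin ((j + 1 : ℕ) * φ)) := by
      rw [twist, hq, hangle, Nat.cast_succ, add_one_mul, Real.cos_add, Real.sin_add]
      ext <;> simp only <;> ring
    have hlt := bounds_of_sqDist_lt_one (hq.trans_lt hr)
    have hlt' := bounds_of_sqDist_lt_one
      (((congrArg sqDist hstep).symm.trans ((sqDist_twist 1 _).trans hq)).trans_lt hr)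
    rw [show 2 * (j + 1) = 2 * j + 1 + 1 by ring, Function.iterate_succ_apply',
      Function.iterate_succ_apply', ih, twistGlide_of_notMem
        (notMem_strip_of_sqDist_lt_one (hq.trans_lt hr)), hstep]
    simp only at hlt hlt'
    rw [twistGlide_of_notMem, twist_of_neg_two_le]
    · simp
    · simp only
      linarith
    · refine notMem_strip_of_one_le ?_
      rw [le_abs]
      left
      simp only
      linarith

/-- The left wing of the continuum. -/
def leftBox : Set (ℝ × ℝ) := Set.Icc (-4) (-1) ×ˢ Set.Icc (-1) 1

/-- The right wing of the continuum. -/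
def rightBox : Set (ℝ × ℝ) := Set.Icc 1 4 ×ˢ Set.Icc (-1) 1

/-- The middle part of the continuum. -/
def diamond : Set (ℝ × ℝ) := {z | |z.1| + |z.2| ≤ 1}

/-- A diamond with two wings attached at its left and right corners. -/
def wingedDiamond : Set (ℝ × ℝ) := diamond ∪ (leftBox ∪ rightBox)

theorem mem_leftBox {z : ℝ × ℝ} : z ∈ leftBox ↔ (-4 ≤ z.1 ∧ z.1 ≤ -1) ∧ -1 ≤ z.2 ∧ z.2 ≤ 1 :=
  Iff.rfl

theorem mem_rightBox {z : ℝ × ℝ} : z ∈ rightBox ↔ (1 ≤ z.1 ∧ z.1 ≤ 4) ∧ -1 ≤ z.2 ∧ z.2 ≤ 1 :=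
  Iff.rfl

theorem mem_diamond {z : ℝ × ℝ} : z ∈ diamond ↔ |z.1| + |z.2| ≤ 1 := Iff.rfl

theorem mem_leftBox_of_sqDist_lt_one {z : ℝ × ℝ} (hz : sqDist z < 1) : z ∈ leftBox := by
  have h := bounds_of_sqDist_lt_one hz
  have h2 := abs_lt.1 h.2.2
  exact ⟨⟨by linarith, by linarith⟩, by linarith, by linarith⟩

theorem notMem_strip_of_mem_leftBox {z : ℝ × ℝ} (hz : z ∈ leftBox) : z ∉ strip :=
  notMem_strip_of_one_le (le_abs.2 (Or.inr (by linarith [hz.1.2])))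

theorem notMem_strip_of_mem_rightBox {z : ℝ × ℝ} (hz : z ∈ rightBox) : z ∉ strip :=
  notMem_strip_of_one_le (le_abs.2 (Or.inl hz.1.1))

theorem neg_fst_mem_leftBox {z : ℝ × ℝ} : (-z.1, z.2) ∈ leftBox ↔ z ∈ rightBox := by
  simp only [mem_leftBox, mem_rightBox]
  constructor <;> rintro ⟨⟨h1, h2⟩, h3⟩ <;> exact ⟨⟨by linarith, by linarith⟩, h3⟩

theorem neg_fst_mem_rightBox {z : ℝ × ℝ} : (-z.1, z.2) ∈ rightBox ↔ z ∈ leftBox := by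
  simp only [mem_leftBox, mem_rightBox]
  constructor <;> rintro ⟨⟨h1, h2⟩, h3⟩ <;> exact ⟨⟨by linarith, by linarith⟩, h3⟩

theorem twistGlide_mem_rightBox {z : ℝ × ℝ} (hz : z ∈ leftBox) : twistGlide z ∈ rightBox := by
  rw [twistGlide_of_notMem (notMem_strip_of_mem_leftBox hz), neg_fst_mem_rightBox]
  exact twist_mem_of_disc_subset (fun _ => mem_leftBox_of_sqDist_lt_one) hz

theorem twistGlide_mem_leftBox {z : ℝ × ℝ} (hz : z ∈ rightBox) : twistGlide z ∈ leftBox := by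
  rw [twistGlide_of_notMem (notMem_strip_of_mem_rightBox hz), neg_fst_mem_leftBox,
    twist_of_neg_two_le]
  · exact hz
  · linarith [hz.1.1]

theorem twistGlide_symm_mem_boxes {z : ℝ × ℝ} (hz : z ∈ leftBox ∪ rightBox) :
    twistGlide.symm z ∈ leftBox ∪ rightBox := by
  obtain h | h := hz
  · rw [twistGlide_symm_of_notMem (notMem_strip_of_mem_leftBox h)]
    have h1 := neg_fst_mem_rightBox.2 h
    rw [twist_of_neg_two_le (by linarith [h1.1.1])]
    exact Or.inr h1
  · rw [twistGlide_symm_of_notMem (notMem_strip_of_mem_rightBox h)]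
    exact Or.inl (twist_mem_of_disc_subset (fun _ => mem_leftBox_of_sqDist_lt_one)
      (neg_fst_mem_leftBox.2 h))

theorem twistGlide_iterate_mem (j : ℕ) {z : ℝ × ℝ} (hz : z ∈ leftBox) :
    (⇑twistGlide)^[2 * j] z ∈ leftBox := by
  induction j with
  | zero => exact hz
  | succ j ih =>
    rw [show 2 * (j + 1) = 2 * j + 1 + 1 by ring, Function.iterate_succ_apply',
      Function.iterate_succ_apply']
    exact twistGlide_mem_leftBox (twistGlide_mem_rightBox ih)

theorem exists_twistGlide_periodic {k : ℕ} (hk : 1 ≤ k) : ∃ x : ℝ × ℝ,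
    (∀ i : ℕ, (⇑twistGlide)^[i] x ∈ wingedDiamond) ∧ (⇑twistGlide)^[2 * k] x = x ∧
      ∀ i : ℕ, 1 ≤ i → i < 2 * k → (⇑twistGlide)^[i] x ≠ x := by
  have hk' : (1 : ℝ) ≤ k := by exact_mod_cast hk
  have hk0 : (0 : ℝ) < k := by linarith
  have hr : √(1 - 1 / (k : ℝ)) ^ 2 = 1 - 1 / (k : ℝ) :=
    Real.sq_sqrt (sub_nonneg.2 ((div_le_one hk0).2 hk'))
  set r := √(1 - 1 / (k : ℝ)) with hrdef
  have hr1 : r ^ 2 < 1 := by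
    rw [hr]
    linarith [one_div_pos.2 hk0]
  have hiter := twistGlide_iterate_two_mul (φ := 2 * Real.pi / k) hr1 (by rw [hr]; ring)
  have hx : ((-3 + r, 0) : ℝ × ℝ) ∈ leftBox :=
    mem_leftBox_of_sqDist_lt_one (by simpa [sqDist] using hr1)
  refine ⟨(-3 + r, 0), fun i => ?_, ?_, fun i hi hik => ?_⟩
  · obtain ⟨j, rfl | rfl⟩ := Nat.even_or_odd' i
    · exact Or.inr (Or.inl (twistGlide_iterate_mem j hx))
    · rw [Function.iterate_succ_apply']
      exact Or.inr (Or.inr (twistGlide_mem_rightBox (twistGlide_iterate_mem j hx)))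
  · rw [hiter, mul_div_cancel₀ _ hk0.ne', Real.cos_two_pi, Real.sin_two_pi]
    simp
  · obtain ⟨j, rfl | rfl⟩ := Nat.even_or_odd' i
    · rw [hiter]
      intro h
      have hj1 : (1 : ℝ) ≤ j := by exact_mod_cast (by omega : 1 ≤ j)
      have hjk : (j : ℝ) < k := by exact_mod_cast (by omega : j < k)
      have hr0 : 0 < r := by
        refine Real.sqrt_pos.2 (sub_pos.2 ((div_lt_one hk0).2 ?_))
        linarith
      have hcos : Real.cos (j * (2 * Real.pi / k)) = 1 := by
        have := congrArg Prod.fst h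
        simp only [add_right_inj] at this
        exact mul_left_cancel₀ hr0.ne' (this.trans (mul_one r).symm)
      have hpi := Real.pi_pos
      have hzero := (Real.cos_eq_one_iff_of_lt_of_lt (by
        have : 0 < j * (2 * Real.pi / k) := by positivity
        linarith) (by
        rw [mul_div_assoc', div_lt_iff₀ hk0]
        nlinarith)).1 hcos
      have : 0 < j * (2 * Real.pi / k) := by positivity
      exact this.ne' hzero
    · rw [Function.iterate_succ_apply']
      intro h
      have h1 := twistGlide_mem_rightBox (twistGlide_iterate_mem j hx)
      rw [h] at h1
      linarith [h1.1.1, hx.1.2]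

theorem chart_mem_diamond {t s : ℝ} : chart (t, s) ∈ diamond ↔ |t| ≤ 1 := by
  have h1 : (0 : ℝ) < 1 + |s| := by positivity
  have h2 : (0 : ℝ) < 1 + |s| * |t| := by positivity
  simp only [mem_diamond, chart, abs_div, abs_of_pos h1, abs_of_pos h2]
  rw [div_add_div _ _ h1.ne' h2.ne', div_le_one (by positivity)]
  constructor <;> intro h <;> nlinarith

theorem mem_wingedDiamond_of_mem_strip {z : ℝ × ℝ} (hz : z ∈ strip) :
    z ∈ wingedDiamond ↔ z ∈ diamond := by
  refine ⟨fun h => ?_, Or.inl⟩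
  obtain h | h | h := h
  · exact h
  · exact absurd hz (notMem_strip_of_mem_leftBox h)
  · exact absurd hz (notMem_strip_of_mem_rightBox h)

theorem mem_wingedDiamond_of_notMem_strip {z : ℝ × ℝ} (hz : z ∉ strip) :
    z ∈ wingedDiamond ↔ z ∈ leftBox ∪ rightBox := by
  refine ⟨fun h => ?_, Or.inr⟩
  obtain h | h := h
  · rw [mem_strip, not_lt] at hz
    rw [mem_diamond] at h
    have h0 : |z.2| = 0 := by nlinarith [abs_nonneg z.2]
    rw [h0] at hz h
    have h2 := abs_eq_zero.1 h0
    obtain h1 | h1 := abs_cases z.1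
    · exact Or.inr ⟨⟨by linarith, by linarith⟩, by simp [h2]⟩
    · exact Or.inl ⟨⟨by linarith, by linarith⟩, by simp [h2]⟩
  · exact h

theorem mem_preimage_union_wingedDiamond {z : ℝ × ℝ} :
    z ∈ ⇑twistGlide ⁻¹' wingedDiamond ∪ wingedDiamond ↔ z ∈ leftBox ∪ rightBox ∨
      |z.1| < 1 ∧ z.2 ≤ 1 - |z.1| ∧ -z.2 * (1 + |z.1|) ≤ 2 * (1 - |z.1|) := by
  by_cases hz : z ∈ strip
  · have hbox : z ∉ leftBox ∪ rightBox := fun h => h.elim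
      (fun h => notMem_strip_of_mem_leftBox h hz) fun h => notMem_strip_of_mem_rightBox h hz
    have habs := abs_fst_lt_one_of_mem_strip hz
    simp only [hbox, false_or, habs, true_and]
    obtain ⟨t, s, rfl⟩ := exists_chart_eq hz
    rw [Set.mem_union, Set.mem_preimage, twistGlide_chart,
      mem_wingedDiamond_of_mem_strip (chart_mem_strip _),
      mem_wingedDiamond_of_mem_strip (chart_mem_strip _), chart_mem_diamond, chart_mem_diamond]
    have h1 : (0 : ℝ) < 1 + |s| := by positivity
    have h2 : (0 : ℝ) < 1 + |s| * |t| := by positivity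
    have e1 : 1 - |s| / (1 + |s|) = 1 / (1 + |s|) := by
      field_simp
      ring
    have e2 : 1 + |s| / (1 + |s|) = (1 + 2 * |s|) / (1 + |s|) := by
      field_simp
      ring
    have hs := abs_nonneg s
    simp only [chart, abs_div, abs_of_pos h1, e1, e2]
    rw [← neg_div, div_le_div_iff₀ h2 h1, div_mul_div_comm, mul_one_div,
      div_le_div_iff₀ (mul_pos h2 h1) h1]
    have e3 : -t * (1 + 2 * |s|) * (1 + |s|) ≤ 2 * ((1 + |s| * |t|) * (1 + |s|)) ↔
        -t * (1 + 2 * |s|) ≤ 2 * (1 + |s| * |t|) := by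
      rw [← mul_assoc, mul_le_mul_iff_of_pos_right h1]
    rw [e3, abs_le, abs_le]
    obtain ⟨ht, ht'⟩ | ⟨ht, ht'⟩ := abs_cases t <;> rw [ht]
    · constructor
      · intro h
        have : t ≤ 1 := by
          obtain h | h := h <;> linarith
        constructor <;> nlinarith [mul_nonneg hs ht']
      · intro h
        right
        constructor <;> nlinarith [mul_nonneg hs ht']
    · have h3 : |s| * t ≤ 0 := mul_nonpos_of_nonneg_of_nonpos hs ht'.le
      constructor
      · intro h
        have : -2 ≤ t := by
          obtain h | h := h <;> linarith
        constructor <;> nlinarith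
      · intro h
        have : -2 ≤ t := by nlinarith
        by_cases h4 : -1 ≤ t
        · right
          constructor <;> linarith
        · left
          constructor <;> linarith
  · have hz' : twistGlide z ∉ strip := by
      rw [twistGlide_of_notMem hz, neg_fst_mem_strip]
      exact twist_notMem_strip hz
    rw [Set.mem_union, Set.mem_preimage, mem_wingedDiamond_of_notMem_strip hz,
      mem_wingedDiamond_of_notMem_strip hz']
    have hexpl : ¬(|z.1| < 1 ∧ z.2 ≤ 1 - |z.1| ∧ -z.2 * (1 + |z.1|) ≤ 2 * (1 - |z.1|)) := by
      rintro ⟨h1, h2, h3⟩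
      rw [mem_strip, not_lt] at hz
      have h0 := abs_nonneg z.1
      have hsq : 0 < (1 - |z.1|) ^ 2 := by
        have : 0 < 1 - |z.1| := by linarith
        positivity
      obtain ⟨h4, h5⟩ | ⟨h4, h5⟩ := abs_cases z.2 <;> rw [h4] at hz <;> nlinarith
    simp only [hexpl, or_false]
    refine ⟨fun h => h.elim (fun h => ?_) id, Or.inr⟩
    simpa using twistGlide_symm_mem_boxes h

theorem isConnected_diamond : IsConnected diamond := by
  refine ⟨⟨0, by simp [mem_diamond]⟩, (Convex.isPreconnected ?_)⟩
  have h : ConvexOn ℝ Set.univ fun z : ℝ × ℝ => |z.1| + |z.2| := by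
    refine ⟨convex_univ, fun x _ y _ a b ha hb _ => ?_⟩
    have h1 := abs_add_le (a * x.1) (b * y.1)
    have h2 := abs_add_le (a * x.2) (b * y.2)
    rw [abs_mul, abs_mul, abs_of_nonneg ha, abs_of_nonneg hb] at h1 h2
    simp only [Prod.fst_add, Prod.smul_fst, Prod.snd_add, Prod.smul_snd, smul_eq_mul]
    linarith
  simpa [diamond] using h.convex_le 1

theorem isConnected_wingedDiamond : IsConnected wingedDiamond := by
  have hl : IsConnected leftBox :=
    (isConnected_Icc (by norm_num)).prod (isConnected_Icc (by norm_num))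
  have hr : IsConnected rightBox :=
    (isConnected_Icc (by norm_num)).prod (isConnected_Icc (by norm_num))
  have h := (isConnected_diamond.union ⟨(-1, 0), by norm_num [mem_diamond, mem_leftBox]⟩ hl).union
    ⟨(1, 0), by norm_num [mem_diamond, mem_rightBox]⟩ hr
  rwa [Set.union_assoc] at h

theorem isCompact_wingedDiamond : IsCompact wingedDiamond := by
  refine IsCompact.union (Metric.isCompact_of_isClosed_isBounded
    (isClosed_le (by fun_prop) continuous_const) ?_)
    ((isCompact_Icc.prod isCompact_Icc).union (isCompact_Icc.prod isCompact_Icc))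
  refine (Metric.isBounded_closedBall (x := (0 : ℝ × ℝ)) (r := 1)).subset fun z hz => ?_
  rw [mem_diamond] at hz
  rw [mem_closedBall_zero_iff]
  exact max_le (by simpa using by linarith [abs_nonneg z.2])
    (by simpa using by linarith [abs_nonneg z.1])

theorem rightBox_subset_wingedDiamond : rightBox ⊆ wingedDiamond := fun _ h => Or.inr (Or.inr h)

theorem nontrivial_wingedDiamond : wingedDiamond.Nontrivial :=
  ⟨(1, 0), rightBox_subset_wingedDiamond (by norm_num [mem_rightBox]), (2, 0),
    rightBox_subset_wingedDiamond (by norm_num [mem_rightBox]), by simp⟩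

theorem isContinuum_wingedDiamond : IsContinuum wingedDiamond :=
  ⟨isCompact_wingedDiamond, isConnected_wingedDiamond, nontrivial_wingedDiamond⟩

theorem isContinuum_preimage_union_wingedDiamond :
    IsContinuum (⇑twistGlide ⁻¹' wingedDiamond ∪ wingedDiamond) := by
  refine ⟨?_, ?_, nontrivial_wingedDiamond.mono Set.subset_union_right⟩
  · exact ((twistGlide.isCompact_preimage).2 isCompact_wingedDiamond).union isCompact_wingedDiamond
  · refine ((twistGlide.isConnected_preimage).2 isConnected_wingedDiamond).union ?_
      isConnected_wingedDiamond
    have h : ((1, 0) : ℝ × ℝ) ∈ rightBox := by norm_num [mem_rightBox]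
    exact ⟨(1, 0), Or.inr (Or.inl (twistGlide_mem_leftBox h)), rightBox_subset_wingedDiamond h⟩

theorem isPreconnected_outside_rectangle :
    IsPreconnected {z : ℝ × ℝ | 4 < |z.1| ∨ 2 < |z.2|} := by
  have h1 : IsPreconnected (Set.Ioi (4 : ℝ) ×ˢ (Set.univ : Set ℝ)) :=
    isPreconnected_Ioi.prod isPreconnected_univ
  have h2 : IsPreconnected ((Set.univ : Set ℝ) ×ˢ Set.Ioi (2 : ℝ)) :=
    isPreconnected_univ.prod isPreconnected_Ioi
  have h3 : IsPreconnected (Set.Iio (-4 : ℝ) ×ˢ (Set.univ : Set ℝ)) :=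
    isPreconnected_Iio.prod isPreconnected_univ
  have h4 : IsPreconnected ((Set.univ : Set ℝ) ×ˢ Set.Iio (-2 : ℝ)) :=
    isPreconnected_univ.prod isPreconnected_Iio
  have h := ((h1.union (5, 3) (by norm_num) (by norm_num) h2).union (-5, 3) (by norm_num)
    (by norm_num) h3).union (5, -3) (by norm_num) (by norm_num) h4
  convert h using 1
  ext z
  simp only [Set.mem_ofPred_eq, lt_abs, Set.mem_union, Set.mem_prod, Set.mem_Ioi, Set.mem_univ,
    Set.mem_Iio, and_true, true_and, lt_neg]
  tauto

theorem mem_boxes {z : ℝ × ℝ} :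
    z ∈ leftBox ∪ rightBox ↔ 1 ≤ |z.1| ∧ |z.1| ≤ 4 ∧ |z.2| ≤ 1 := by
  rw [Set.mem_union, mem_leftBox, mem_rightBox, le_abs, abs_le, abs_le]
  constructor
  · rintro (⟨⟨h1, h2⟩, h3⟩ | ⟨⟨h1, h2⟩, h3⟩)
    · exact ⟨Or.inr (by linarith), ⟨by linarith, by linarith⟩, h3⟩
    · exact ⟨Or.inl (by linarith), ⟨by linarith, by linarith⟩, h3⟩
  · rintro ⟨h1 | h1, ⟨h2, h3⟩, h4⟩
    · exact Or.inr ⟨⟨by linarith, by linarith⟩, h4⟩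
    · exact Or.inl ⟨⟨by linarith, by linarith⟩, h4⟩

theorem isAcyclic_preimage_union_wingedDiamond :
    IsAcyclic (⇑twistGlide ⁻¹' wingedDiamond ∪ wingedDiamond) := by
  set K := ⇑twistGlide ⁻¹' wingedDiamond ∪ wingedDiamond with hK
  have hmem : ∀ x y : ℝ, (x, y) ∈ Kᶜ ↔ ¬((1 ≤ |x| ∧ |x| ≤ 4 ∧ |y| ≤ 1) ∨
      |x| < 1 ∧ y ≤ 1 - |x| ∧ -y * (1 + |x|) ≤ 2 * (1 - |x|)) := fun x y => by
    rw [Set.mem_compl_iff, hK, mem_preimage_union_wingedDiamond, mem_boxes]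
  set E := {z : ℝ × ℝ | 4 < |z.1| ∨ 2 < |z.2|} with hE
  have hEK : E ⊆ Kᶜ := by
    rintro ⟨x, y⟩ hz
    rw [hmem]
    have h0 := abs_nonneg x
    simp only [hE, Set.mem_ofPred_eq, lt_abs (b := y)] at hz
    rintro (⟨h1, h2, h3⟩ | ⟨h1, h2, h3⟩)
    · rw [abs_le] at h3
      obtain hz | hz | hz := hz <;> linarith
    · obtain hz | hz | hz := hz <;> nlinarith
  have hbase : ((5, 0) : ℝ × ℝ) ∈ E := Or.inl (by norm_num)
  refine ⟨⟨_, hEK hbase⟩, isPreconnected_of_forall (5, 0) fun z hz => ?_⟩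
  obtain ⟨x, y⟩ := z
  obtain ⟨y', hy', hray⟩ : ∃ y' : ℝ, 2 < |y'| ∧ ∀ w ∈ Set.uIcc y y', (x, w) ∈ Kᶜ := by
    by_cases hbig : 4 < |x|
    · exact ⟨3, by norm_num, fun w _ => hEK (Or.inl hbig)⟩
    rw [not_lt] at hbig
    have key : (∀ w, y ≤ w → (x, w) ∈ Kᶜ) ∨ ∀ w, w ≤ y → (x, w) ∈ Kᶜ := by
      simp only [hmem] at hz ⊢
      have h0 := abs_nonneg x
      obtain h1 | h1 := lt_or_ge |x| 1
      · by_cases h2 : y ≤ 1 - |x|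
        · have h3 : 2 * (1 - |x|) < -y * (1 + |x|) := not_le.1 fun h => hz (Or.inr ⟨h1, h2, h⟩)
          right
          rintro w hw (⟨h, -⟩ | ⟨-, -, h⟩) <;> nlinarith
        · left
          rintro w hw (⟨h, -⟩ | ⟨-, h, -⟩) <;> linarith
      · have h2 : 1 < |y| := not_le.1 fun h => hz (Or.inl ⟨h1, hbig, h⟩)
        obtain h2 | h2 := lt_abs.1 h2
        · left
          rintro w hw (⟨-, -, h⟩ | ⟨h, -⟩)
          · linarith [(abs_le.1 h).2]
          · linarith
        · right
          rintro w hw (⟨-, -, h⟩ | ⟨h, -⟩)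
          · linarith [(abs_le.1 h).1]
          · linarith
    obtain h | h := key
    · refine ⟨max y 3, ?_, fun w hw => h w ?_⟩
      · exact lt_abs.2 (Or.inl (lt_max_of_lt_right (by norm_num)))
      · rw [Set.uIcc_of_le (le_max_left _ _)] at hw
        exact hw.1
    · refine ⟨min y (-3), ?_, fun w hw => h w ?_⟩
      · exact lt_abs.2 (Or.inr (lt_neg.2 (min_lt_of_right_lt (by norm_num))))
      · rw [Set.uIcc_of_ge (min_le_left _ _)] at hw
        exact hw.2
  have hseg : IsPreconnected ((fun w => (x, w)) '' Set.uIcc y y') :=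
    isPreconnected_uIcc.image _ (by fun_prop)
  refine ⟨E ∪ (fun w => (x, w)) '' Set.uIcc y y', ?_, Or.inl hbase,
    Or.inr ⟨y, Set.left_mem_uIcc, rfl⟩, ?_⟩
  · rintro _ (h | ⟨w, hw, rfl⟩)
    · exact hEK h
    · exact hray w hw
  · exact isPreconnected_outside_rectangle.union (x, y') (Or.inr hy')
      ⟨y', Set.right_mem_uIcc, rfl⟩ hseg

/-- **Theorem 4.1.** There exist an orientation reversing planar homeomorphism
`H` and a continuum `C` such that `H⁻¹(C) ∪ C` is an acyclic continuum
containing a periodic orbit of least period `2k` for every `k ≥ 1`, every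
orbit of `H` is bounded, and `H` has no fixed points. -/
theorem exists_orientation_reversing_no_fixed_point :
    ∃ (H : (ℝ × ℝ) ≃ₜ (ℝ × ℝ)) (C : Set (ℝ × ℝ)),
      ¬ IsotopicToIdentity H ∧
      IsContinuum C ∧
      IsContinuum (⇑H ⁻¹' C ∪ C) ∧ IsAcyclic (⇑H ⁻¹' C ∪ C) ∧
      (∀ k : ℕ, 1 ≤ k → ∃ x : ℝ × ℝ,
        (∀ i : ℕ, (⇑H)^[i] x ∈ ⇑H ⁻¹' C ∪ C) ∧
        (⇑H)^[2 * k] x = x ∧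
        ∀ i : ℕ, 1 ≤ i → i < 2 * k → (⇑H)^[i] x ≠ x) ∧
      (∀ p : ℝ × ℝ, Bornology.IsBounded
        {q : ℝ × ℝ | ∃ n : ℕ, q = (⇑H)^[n] p ∨ q = (⇑H.symm)^[n] p}) ∧
      (∀ p : ℝ × ℝ, H p ≠ p) := by 
  refine ⟨twistGlide, wingedDiamond, not_isotopicToIdentity_twistGlide,
    isContinuum_wingedDiamond, isContinuum_preimage_union_wingedDiamond,
    isAcyclic_preimage_union_wingedDiamond, fun k hk => ?_, fun p => ?_, twistGlide_ne_self⟩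
  · obtain ⟨x, hx, hper⟩ := exists_twistGlide_periodic hk
    exact ⟨x, fun i => Or.inr (hx i), hper⟩
  · refine ((isBounded_range_iterate_twistGlide p).union
      (isBounded_range_iterate_twistGlide_symm p)).subset ?_
    rintro _ ⟨n, rfl | rfl⟩
    · exact Or.inl ⟨n, rfl⟩
    · exact Or.inr ⟨n, rfl⟩
end

section
/- Define h : ℝ² → ℝ² by h(x, y) = (−x − x·|x|, y + y·|1 − y|) and let C = {(0, y) : y ∈ [0, 1]}. Then for every point c = (0, y) with 0 < y < 1, the full orbit {hⁿ(c) : n ∈ ℤ} is contained in C, and c is not periodic: hⁿ(c) ≠ c for every integer n ≥ 1. In particular, C contains infinite non-periodic orbits of h while h has no points of least period 2, so a non-periodic orbit contained in C does not force the existence of a 2-periodic point. -/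
open Filter in
/-- A continuous strictly increasing function that moves points of `ℝ` away from `0`
is a homeomorphism of `ℝ`. -/
theorem exists_homeomorph_of_strictMono {f : ℝ → ℝ} (hf : StrictMono f) (hc : Continuous f)
    (hpos : ∀ x, 0 ≤ x → x ≤ f x) (hneg : ∀ x, x ≤ 0 → f x ≤ x) :
    ∃ e : ℝ ≃ₜ ℝ, ∀ x, e x = f x := by
  have hs : Function.Surjective f := hc.surjective
    (tendsto_atTop_mono' _ ((eventually_ge_atTop 0).mono hpos) tendsto_id)
    (tendsto_atBot_mono' _ ((eventually_le_atBot 0).mono hneg) tendsto_id)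
  exact ⟨(hf.orderIsoOfSurjective f hs).toHomeomorph, fun _ => rfl⟩

theorem strictMono_add_mul_abs : StrictMono fun x : ℝ => x + x * |x| := by
  intro a b hab
  dsimp only
  rcases abs_cases a with ⟨ha, ha'⟩ | ⟨ha, ha'⟩ <;> rcases abs_cases b with ⟨hb, hb'⟩ | ⟨hb, hb'⟩ <;>
    rw [ha, hb] <;> nlinarith

theorem strictMono_add_mul_abs_one_sub : StrictMono fun y : ℝ => y + y * |1 - y| := by
  intro a b hab
  dsimp only
  rcases abs_cases (1 - a) with ⟨ha, ha'⟩ | ⟨ha, ha'⟩ <;>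
    rcases abs_cases (1 - b) with ⟨hb, hb'⟩ | ⟨hb, hb'⟩ <;>
    rw [ha, hb] <;> nlinarith


/-- For the homeomorphism `h(x, y) = (−x − x|x|, y + y|1 − y|)` and the arc
`C = {0} × [0, 1]`: every point `c = (0, y)` with `0 < y < 1` has its full
orbit `{hⁿ(c) : n ∈ ℤ}` contained in `C` and is not periodic, while `h` has
no point of least period `2` (every point of period `2` is fixed). -/
theorem nonperiodic_orbit_in_arc
    (C : Set (ℝ × ℝ))
    (hCdef : C = {p : ℝ × ℝ | p.1 = 0 ∧ p.2 ∈ Set.Icc (0 : ℝ) 1}) :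
    ∃ h : (ℝ × ℝ) ≃ₜ (ℝ × ℝ),
      (∀ p : ℝ × ℝ, h p = (-p.1 - p.1 * |p.1|, p.2 + p.2 * |1 - p.2|)) ∧
      (∀ y : ℝ, 0 < y → y < 1 →
        (∀ n : ℕ, (⇑h)^[n] ((0 : ℝ), y) ∈ C ∧ (⇑h.symm)^[n] ((0 : ℝ), y) ∈ C) ∧
        (∀ n : ℕ, 1 ≤ n → (⇑h)^[n] ((0 : ℝ), y) ≠ ((0 : ℝ), y))) ∧
      (∀ p : ℝ × ℝ, (⇑h)^[2] p = p → h p = p) := by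
  have hF := strictMono_add_mul_abs
  have hG := strictMono_add_mul_abs_one_sub
  obtain ⟨F, hFe⟩ := exists_homeomorph_of_strictMono hF (by fun_prop)
    (fun x hx => by nlinarith [abs_nonneg x]) (fun x hx => by nlinarith [abs_nonneg x])
  obtain ⟨G, hGe⟩ := exists_homeomorph_of_strictMono hG (by fun_prop)
    (fun x hx => by nlinarith [abs_nonneg (1 - x)]) (fun x hx => by nlinarith [abs_nonneg (1 - x)])
  have hGmono : StrictMono G := by simpa only [← hGe] using hG
  have hG0 : G 0 = 0 := by simp [hGe]
  have hG1 : G 1 = 1 := by simp [hGe]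
  have hF0 : F 0 = 0 := by simp [hFe]
  let h : (ℝ × ℝ) ≃ₜ (ℝ × ℝ) := (F.trans (Homeomorph.neg ℝ)).prodCongr G
  have hh : ∀ p, h p = (-F p.1, G p.2) := fun _ => rfl
  have forward : ∀ z : ℝ, h (0, z) = (0, G z) := fun z => by simp [hh, hF0]
  have backward : ∀ z : ℝ, h.symm (0, z) = (0, G.symm z) := fun z => by
    rw [Homeomorph.symm_apply_eq, forward, G.apply_symm_apply]
  have hGlt : ∀ z, 0 < z → z < 1 → z < G z ∧ G z < 1 := fun z h0 h1 => by
    refine ⟨?_, hG1 ▸ hGmono h1⟩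
    rw [hGe, abs_of_pos (by linarith)]
    nlinarith
  refine ⟨h, fun p => ?_, fun y hy0 hy1 => ?_, fun p hp => ?_⟩
  · rw [hh, hFe, hGe, neg_add']
  · have hfor : ∀ n : ℕ, ∃ z, h^[n] (0, y) = (0, z) ∧ y ≤ z ∧ z < 1 ∧ (1 ≤ n → y < z) := by
      intro n
      induction n with
      | zero => exact ⟨y, rfl, le_rfl, hy1, by simp⟩
      | succ n ih =>
        obtain ⟨z, hz, hyz, hz1, -⟩ := ih
        obtain ⟨h2, h3⟩ := hGlt z (hy0.trans_le hyz) hz1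
        exact ⟨G z, by rw [Function.iterate_succ_apply', hz, forward], hyz.trans h2.le, h3,
          fun _ => hyz.trans_lt h2⟩
    have hback : ∀ n : ℕ, ∃ z, h.symm^[n] (0, y) = (0, z) ∧ 0 < z ∧ z < 1 := by
      intro n
      induction n with
      | zero => exact ⟨y, rfl, hy0, hy1⟩
      | succ n ih =>
        obtain ⟨z, hz, hz0, hz1⟩ := ih
        refine ⟨G.symm z, by rw [Function.iterate_succ_apply', hz, backward], ?_, ?_⟩
        · rwa [← hGmono.lt_iff_lt, hG0, G.apply_symm_apply]
        · rwa [← hGmono.lt_iff_lt, hG1, G.apply_symm_apply]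
    refine ⟨fun n => ⟨?_, ?_⟩, fun n hn => ?_⟩
    · obtain ⟨z, hz, hyz, hz1, -⟩ := hfor n
      rw [hz, hCdef]
      exact ⟨rfl, hy0.le.trans hyz, hz1.le⟩
    · obtain ⟨z, hz, hz0, hz1⟩ := hback n
      rw [hz, hCdef]
      exact ⟨rfl, hz0.le, hz1.le⟩
    · obtain ⟨z, hz, -, -, hlt⟩ := hfor n
      rw [hz]
      exact fun he => (hlt hn).ne' (congrArg Prod.snd he)
  · obtain ⟨x, y⟩ := p
    have hp' : h (h (x, y)) = (x, y) := hp
    simp only [hh, Prod.mk.injEq] at hp' ⊢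
    obtain ⟨hx, hy⟩ := hp'
    have hx0 : x = 0 := by
      rw [hFe, hFe, abs_neg] at hx
      have hpos := abs_nonneg (x + x * |x|)
      have habs := abs_nonneg x
      rcases lt_trichotomy x 0 with hlt | heq | hgt
      · nlinarith [mul_nonneg (neg_nonneg.2 hlt.le) habs,
          mul_nonneg (mul_nonneg (neg_nonneg.2 hlt.le) habs) hpos, abs_of_neg hlt]
      · exact heq
      · nlinarith [mul_nonneg hgt.le habs, mul_nonneg (mul_nonneg hgt.le habs) hpos, abs_of_pos hgt]
    refine ⟨by simp [hx0, hF0], ?_⟩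
    rcases lt_trichotomy (G y) y with hlt | heq | hgt
    · linarith [hGmono hlt]
    · exact heq
    · linarith [hGmono hgt]
end
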